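/- arXiv:2102.07184 — 2 statements merged into one kernel-verified Lean document; each statement's English description precedes it below -/
import Mathlib

section
/- For every integer k ≥ 3, Σ_{j=2}^{k−1} 2^{j} ζ₂(j, \overline{k−j}) = 4(k−1)(1 − 1/2^{k}) ζ(k), where ζ₂(j, \overline{k−j}) = 4 Σ_{m>n>0, m even, n odd} 1/(m^j n^{k−j}). -/
/-- The double zeta value of level 2 with prescribed parities:
`levelTwoDoubleZeta a b j l = 4 Σ_{m>n>0, m≡a, n≡b (mod 2)} 1/(m^j n^l)`. -/
noncomputable def levelTwoDoubleZeta (a b : ℕ) (j l : ℕ) : ℝ :=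
  4 * ∑' p : {p : ℕ × ℕ // p.2 < p.1 ∧ 0 < p.2 ∧ p.1 % 2 = a ∧ p.2 % 2 = b},
    1 / ((p.1.1 : ℝ) ^ j * (p.1.2 : ℝ) ^ l)

/-- The Riemann zeta value as a series. -/
noncomputable def singleZeta (k : ℕ) : ℝ :=
  ∑' m : {m : ℕ // 0 < m}, 1 / (m.1 : ℝ) ^ k

/-- The summand `1 / (M ^ j * n ^ l)` at `(M, n)`, restricted to odd `n < 2 * M`. -/
noncomputable def oddBelowTerm (j l : ℕ) (p : ℕ × ℕ) : ℝ :=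
  if p.2 < 2 * p.1 ∧ p.2 % 2 = 1 then 1 / ((p.1 : ℝ) ^ j * (p.2 : ℝ) ^ l) else 0

/-- The part `1 / (M ^ (q + 1) * (n - M))` of the geometric sum, antisymmetric under
`n ↦ 2 * M - n`. -/
noncomputable def antisymmTerm (q : ℕ) (p : ℕ × ℕ) : ℝ :=
  if p.2 < 2 * p.1 ∧ p.2 % 2 = 1 then
    1 / (p.1 : ℝ) ^ (q + 1) * (1 / ((p.2 : ℝ) - p.1)) else 0

/-- The part of the geometric sum that telescopes in `M`. -/
noncomputable def telescopingTerm (q : ℕ) (p : ℕ × ℕ) : ℝ :=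
  if p.2 < 2 * p.1 ∧ p.2 % 2 = 1 then
    1 / (p.2 : ℝ) ^ (q + 1) * (1 / ((p.1 : ℝ) - p.2) - 1 / p.1) else 0

/-- The diagonal part of the geometric sum. -/
noncomputable def diagonalTerm (q : ℕ) (p : ℕ × ℕ) : ℝ :=
  if p.1 = p.2 ∧ p.2 % 2 = 1 then ((q : ℝ) + 1) / (p.2 : ℝ) ^ (q + 2) else 0

theorem levelTwoDoubleZeta_eq_tsum (j l : ℕ) :
    2 ^ j * levelTwoDoubleZeta 0 1 j l = 4 * ∑' p, oddBelowTerm j l p := by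
  have h1 := tsum_subtype {p : ℕ × ℕ | p.2 < p.1 ∧ 0 < p.2 ∧ p.1 % 2 = 0 ∧ p.2 % 2 = 1}
    (fun p => 1 / ((p.1 : ℝ) ^ j * (p.2 : ℝ) ^ l))
  have hg : Function.Injective (fun p : ℕ × ℕ => (2 * p.1, p.2)) := by
    rintro ⟨a, b⟩ ⟨c, d⟩ h
    simp only [Prod.mk.injEq] at h ⊢
    omega
  rw [← hg.tsum_eq] at h1
  · rw [levelTwoDoubleZeta]
    erw [h1]
    rw [mul_left_comm, ← tsum_mul_left]
    congr 1
    refine tsum_congr fun p => ?_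
    simp only [Set.indicator_apply, Set.mem_ofPred_eq, oddBelowTerm]
    by_cases hp : p.2 < 2 * p.1 ∧ p.2 % 2 = 1
    · rw [if_pos hp, if_pos (by omega)]
      push_cast
      rw [mul_pow, mul_assoc, ← div_div]
      field_simp
    · rw [if_neg hp, if_neg (by omega), mul_zero]
  · intro p hp
    have hp' := Set.mem_of_indicator_ne_zero hp
    simp only [Set.mem_ofPred_eq] at hp'
    exact ⟨(p.1 / 2, p.2), Prod.ext (by simp; omega) rfl⟩

theorem one_div_sq_mul_le {x y c : ℝ} (hx : 0 < x) (hy : 0 < y) (hc : 0 ≤ c)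
    (h : y ≤ c ^ 2 * x) :
    1 / (x ^ 2 * y) ≤ c * (x ^ (-(3 / 2) : ℝ) * y ^ (-(3 / 2) : ℝ)) := by
  have e : ∀ z : ℝ, 0 < z → z ^ (-(3 / 2) : ℝ) = 1 / (z * √z) := by
    intro z hz
    rw [Real.rpow_neg hz.le, show (3 / 2 : ℝ) = 1 + 1 / 2 by norm_num, Real.rpow_add hz,
      Real.rpow_one, Real.sqrt_eq_rpow, one_div (z * _)]
  rw [e x hx, e y hy]
  have hsx := Real.sqrt_pos.2 hx
  have hsy := Real.sqrt_pos.2 hy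
  have hle : √y ≤ c * √x := by
    rw [← Real.sqrt_sq hc, ← Real.sqrt_mul (sq_nonneg c)]
    exact Real.sqrt_le_sqrt h
  have hxx : x ^ 2 = x * √x * √x := by
    rw [mul_assoc, Real.mul_self_sqrt hx.le, sq]
  rw [hxx, div_mul_div_comm, mul_one, ← mul_div_assoc, mul_one,
    div_le_div_iff₀ (by positivity) (by positivity)]
  have := mul_le_mul_of_nonneg_left hle (by positivity : 0 ≤ x * √x * y)
  linarith

theorem summable_oddBelowTerm (j l : ℕ) : Summable (oddBelowTerm (j + 2) (l + 1)) := by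
  have hs : Summable (fun n : ℕ => (n : ℝ) ^ (-(3 / 2) : ℝ)) :=
    Real.summable_nat_rpow.2 (by norm_num)
  have h := (hs.mul_of_nonneg hs (fun _ => by positivity) (fun _ => by positivity)).mul_left 2
  refine Summable.of_nonneg_of_le (fun p => ?_) (fun p => ?_) h
  · unfold oddBelowTerm; positivity
  · unfold oddBelowTerm
    split_ifs with hp
    · have h1 : (1 : ℝ) ≤ p.1 := by exact_mod_cast (by omega : 1 ≤ p.1)
      have h2 : (1 : ℝ) ≤ p.2 := by exact_mod_cast (by omega : 1 ≤ p.2)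
      have h3 : (p.2 : ℝ) ≤ 2 ^ 2 * p.1 := by exact_mod_cast (by omega : p.2 ≤ 2 ^ 2 * p.1)
      refine le_trans ?_ (one_div_sq_mul_le (by linarith) (by linarith) zero_le_two h3)
      apply one_div_le_one_div_of_le (by positivity)
      gcongr
      · omega
      · exact le_self_pow₀ h2 (by omega)
    · positivity

theorem summable_antisymmTerm (q : ℕ) : Summable (antisymmTerm (q + 1)) := by
  have hs : Summable (fun n : ℕ => (n : ℝ) ^ (-(3 / 2) : ℝ)) :=
    Real.summable_nat_rpow.2 (by norm_num)
  have hz : Summable (fun n : ℤ => |(n : ℝ)| ^ (-(3 / 2) : ℝ)) :=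
    Real.summable_abs_int_rpow (by norm_num)
  have h := hs.mul_of_nonneg hz (fun _ => by positivity) (fun _ => by positivity)
  have hg : Function.Injective (fun p : ℕ × ℕ => (p.1, (p.2 : ℤ) - p.1)) := by
    rintro ⟨a, b⟩ ⟨c, d⟩ h
    simp only [Prod.mk.injEq] at h ⊢
    omega
  refine Summable.of_norm_bounded (h.comp_injective hg) fun p => ?_
  simp only [Function.comp_apply]
  unfold antisymmTerm
  split_ifs with hp
  · have h1 : (1 : ℝ) ≤ p.1 := by exact_mod_cast (by omega : 1 ≤ p.1)
    push_cast
    by_cases hd : (p.2 : ℝ) - p.1 = 0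
    · rw [hd]; simp
    · have hd' := abs_pos.2 hd
      have h3 : |(p.2 : ℝ) - p.1| ≤ 1 ^ 2 * p.1 := by
        have : (p.2 : ℝ) ≤ 2 * p.1 := by exact_mod_cast hp.1.le
        rw [abs_le]; constructor <;> linarith [(Nat.cast_nonneg p.2 : (0 : ℝ) ≤ p.2)]
      have := one_div_sq_mul_le (by linarith) hd' zero_le_one h3
      rw [one_mul] at this
      refine le_trans ?_ this
      rw [div_mul_div_comm, mul_one, Real.norm_eq_abs, abs_div, abs_mul, abs_one,
        abs_of_nonneg (by positivity : (0 : ℝ) ≤ (p.1 : ℝ) ^ (q + 1 + 1))]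
      apply one_div_le_one_div_of_le (by positivity)
      gcongr
      omega
  · rw [norm_zero]; positivity

theorem tsum_antisymmTerm_row (q M : ℕ) : ∑' n, antisymmTerm q (M, n) = 0 := by
  rw [tsum_eq_sum (s := Finset.range (2 * M + 1))]
  · have h := Finset.sum_range_reflect (fun n => antisymmTerm q (M, n)) (2 * M + 1)
    have h' : ∑ n ∈ Finset.range (2 * M + 1), antisymmTerm q (M, 2 * M + 1 - 1 - n)
        = - ∑ n ∈ Finset.range (2 * M + 1), antisymmTerm q (M, n) := by
      rw [← Finset.sum_neg_distrib]
      refine Finset.sum_congr rfl fun n hn => ?_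
      rw [Finset.mem_range] at hn
      unfold antisymmTerm
      by_cases hp : n < 2 * M ∧ n % 2 = 1
      · rw [if_pos hp, if_pos (by dsimp only; omega)]
        have : ((2 * M + 1 - 1 - n : ℕ) : ℝ) = 2 * M - n := by
          rw [Nat.add_sub_cancel, Nat.cast_sub (by omega)]; push_cast; rfl
        dsimp only
        rw [this, show (2 * (M : ℝ) - n - M) = -(n - M) by ring, one_div_neg_eq_neg_one_div]
        ring
      · rw [if_neg hp, if_neg (by dsimp only; omega), neg_zero]
    linarith
  · intro n hn
    rw [Finset.mem_range] at hn
    exact if_neg (by dsimp only; omega)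

theorem sum_range_sub_shift (h : ℕ → ℝ) (p N : ℕ) :
    ∑ i ∈ Finset.range N, (h i - h (i + p))
      = ∑ i ∈ Finset.range p, h i - ∑ i ∈ Finset.range p, h (N + i) := by
  have h1 := Finset.sum_range_add h N p
  have h2 := Finset.sum_range_add h p N
  rw [add_comm p N] at h2
  simp only [add_comm p] at h2
  rw [Finset.sum_sub_distrib]
  linarith

theorem tsum_telescopingTerm_column (q n : ℕ)
    (hs : Summable fun M => telescopingTerm q (M, n)) :
    ∑' M, telescopingTerm q (M, n) = 0 := by
  rcases Nat.mod_two_eq_zero_or_one n with hn | hn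
  · simp [telescopingTerm, hn]
  obtain ⟨a, rfl⟩ : ∃ a, n = 2 * a + 1 := ⟨n / 2, by omega⟩
  rw [← hs.sum_add_tsum_nat_add (a + 1), Finset.sum_eq_zero, zero_add]
  · set h : ℕ → ℝ := fun i => 1 / ((i : ℝ) - a) with hh
    have he : ∀ i, telescopingTerm q (i + (a + 1), 2 * a + 1)
        = 1 / ((2 * a + 1 : ℕ) : ℝ) ^ (q + 1) * (h i - h (i + (2 * a + 1))) := by
      intro i
      rw [telescopingTerm, if_pos (by dsimp only; omega), hh]
      push_cast
      ring_nf
    have hlim : Filter.Tendsto h Filter.atTop (nhds 0) := by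
      have := Filter.tendsto_atTop_add_const_right Filter.atTop (-(a : ℝ))
        (tendsto_natCast_atTop_atTop (R := ℝ))
      exact this.inv_tendsto_atTop.congr fun i => by simp [hh, sub_eq_add_neg]
    have hzero : ∑ i ∈ Finset.range (2 * a + 1), h i = 0 := by
      have h1 := Finset.sum_range_reflect h (2 * a + 1)
      have h2 : ∑ i ∈ Finset.range (2 * a + 1), h (2 * a + 1 - 1 - i)
          = - ∑ i ∈ Finset.range (2 * a + 1), h i := by
        rw [← Finset.sum_neg_distrib]
        refine Finset.sum_congr rfl fun i hi => ?_
        rw [Finset.mem_range] at hi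
        simp only [hh]
        rw [Nat.add_sub_cancel, Nat.cast_sub (by omega), ← one_div_neg_eq_neg_one_div]
        push_cast
        ring_nf
      linarith
    have hs' := (summable_nat_add_iff (a + 1)).2 hs
    refine tendsto_nhds_unique hs'.hasSum.tendsto_sum_nat ?_
    simp only [he, ← Finset.mul_sum, sum_range_sub_shift, hzero]
    have : Filter.Tendsto (fun N => ∑ i ∈ Finset.range (2 * a + 1), h (N + i)) Filter.atTop
        (nhds (∑ i ∈ Finset.range (2 * a + 1), 0)) :=
      tendsto_finsetSum _ fun i _ => hlim.comp (Filter.tendsto_add_atTop_nat i)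
    simpa using (this.const_sub 0).const_mul (1 / ((2 * a + 1 : ℕ) : ℝ) ^ (q + 1))
  · intro M hM
    rw [Finset.mem_range] at hM
    exact if_neg (by dsimp only; omega)

theorem geom_sum_one_div_of_ne {x y : ℝ} (hx : x ≠ 0) (hy : y ≠ 0) (hxy : x ≠ y) (q : ℕ) :
    ∑ i ∈ Finset.range q, 1 / (x ^ (i + 2) * y ^ (q - i))
      = 1 / x ^ (q + 1) * (1 / (y - x)) + 1 / y ^ (q + 1) * (1 / (x - y) - 1 / x) := by
  have h1 : x - y ≠ 0 := sub_ne_zero.2 hxy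
  have h2 : y - x ≠ 0 := sub_ne_zero.2 hxy.symm
  have h3 : 1 / (x - y) = - (1 / (y - x)) := by rw [← one_div_neg_eq_neg_one_div, neg_sub]
  rw [h3]
  induction q with
  | zero => field_simp; simp; ring
  | succ q ih =>
    have hstep : ∑ i ∈ Finset.range q, 1 / (x ^ (i + 2) * y ^ (q + 1 - i))
        = (∑ i ∈ Finset.range q, 1 / (x ^ (i + 2) * y ^ (q - i))) * (1 / y) := by
      rw [Finset.sum_mul]
      refine Finset.sum_congr rfl fun i hi => ?_
      rw [Finset.mem_range] at hi
      rw [Nat.sub_add_comm hi.le, pow_succ, div_mul_div_comm]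
      ring_nf
    rw [Finset.sum_range_succ, hstep, ih, Nat.add_sub_cancel_left]
    field_simp
    ring

theorem sum_oddBelowTerm (q : ℕ) (p : ℕ × ℕ) :
    ∑ i ∈ Finset.range q, oddBelowTerm (i + 2) (q - i) p
      = antisymmTerm q p + telescopingTerm q p + diagonalTerm q p := by
  unfold oddBelowTerm antisymmTerm telescopingTerm diagonalTerm
  by_cases hp : p.2 < 2 * p.1 ∧ p.2 % 2 = 1
  · simp only [if_pos hp]
    have h1 : (p.1 : ℝ) ≠ 0 := by exact_mod_cast (by omega : p.1 ≠ 0)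
    have h2 : (p.2 : ℝ) ≠ 0 := by exact_mod_cast (by omega : p.2 ≠ 0)
    by_cases h : p.1 = p.2
    · rw [if_pos ⟨h, hp.2⟩, h]
      have : ∀ i ∈ Finset.range q, 1 / ((p.2 : ℝ) ^ (i + 2) * (p.2 : ℝ) ^ (q - i))
          = 1 / (p.2 : ℝ) ^ (q + 2) := by
        intro i hi
        rw [Finset.mem_range] at hi
        rw [← pow_add]
        congr 2
        omega
      rw [Finset.sum_congr rfl this]
      simp only [Finset.sum_const, Finset.card_range, nsmul_eq_mul, sub_self, div_zero]
      field_simp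
      ring
    · rw [if_neg (by tauto), add_zero,
        geom_sum_one_div_of_ne h1 h2 (by exact_mod_cast h)]
  · simp only [if_neg hp]
    rw [if_neg (by omega)]
    simp

theorem hasSum_odd_one_div_pow {k : ℕ} (hk : 1 < k) :
    HasSum (fun n : ℕ => if n % 2 = 1 then 1 / (n : ℝ) ^ k else 0)
      ((1 - 1 / 2 ^ k) * singleZeta k) := by
  have hs := Real.summable_one_div_nat_pow.2 hk
  have hz : singleZeta k = ∑' n : ℕ, 1 / (n : ℝ) ^ k := by
    have h := tsum_subtype {m : ℕ | 0 < m} (fun m => 1 / (m : ℝ) ^ k)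
    refine Eq.trans h (tsum_congr fun n => ?_)
    by_cases hn : 0 < n
    · exact Set.indicator_of_mem (s := {m : ℕ | 0 < m}) hn _
    · obtain rfl : n = 0 := by omega
      simp [show k ≠ 0 by omega]
  have heven : HasSum (fun n : ℕ => if n % 2 = 1 then 0 else 1 / (n : ℝ) ^ k)
      (1 / 2 ^ k * singleZeta k) := by
    have hg : Function.Injective (fun n : ℕ => 2 * n) := fun a b h => by simpa using h
    rw [← hg.hasSum_iff]
    · rw [hz]
      refine (hs.hasSum.mul_left (1 / 2 ^ k)).congr_fun ?_
      intro n
      simp [mul_pow, mul_comm]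
    · intro n hn
      refine if_pos ?_
      by_contra h
      exact hn ⟨n / 2, by dsimp only; omega⟩
  have hall := hs.hasSum
  rw [← hz] at hall
  rw [sub_mul, one_mul]
  refine (hall.sub heven).congr_fun fun n => ?_
  split_ifs <;> simp

theorem hasSum_diagonalTerm (q : ℕ) :
    HasSum (diagonalTerm q) (((q : ℝ) + 1) * ((1 - 1 / 2 ^ (q + 2)) * singleZeta (q + 2))) := by
  have hg : Function.Injective (fun n : ℕ => (n, n)) := fun a b h => (Prod.mk.inj h).1
  rw [← hg.hasSum_iff]
  · refine ((hasSum_odd_one_div_pow (k := q + 2) (by omega)).mul_left ((q : ℝ) + 1)).congr_fun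
      fun n => ?_
    simp only [Function.comp_apply, diagonalTerm, true_and]
    split_ifs <;> simp [div_eq_mul_inv]
  · rintro ⟨a, b⟩ hp
    refine if_neg fun h => hp ⟨a, ?_⟩
    exact Prod.ext rfl h.1

theorem weighted_sum_formula_level2_zeta_mixed (k : ℕ) (hk : 3 ≤ k) :
    ∑ j ∈ Finset.Icc 2 (k - 1), (2 : ℝ) ^ j * levelTwoDoubleZeta 0 1 j (k - j)
      = 4 * ((k : ℝ) - 1) * (1 - 1 / 2 ^ k) * singleZeta k := by
  obtain ⟨q, rfl⟩ : ∃ q, k = q + 1 + 2 := ⟨k - 3, by omega⟩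
  have hF : ∀ i ∈ Finset.range (q + 1), Summable (oddBelowTerm (i + 2) (q + 1 - i)) := by
    intro i hi
    rw [Finset.mem_range] at hi
    rw [Nat.sub_add_comm (by omega)]
    exact summable_oddBelowTerm i (q - i)
  have hA := summable_antisymmTerm q
  have hD := hasSum_diagonalTerm (q + 1)
  have hB : Summable (telescopingTerm (q + 1)) := by
    refine (((summable_sum hF).sub hA).sub hD.summable).congr fun p => ?_
    rw [sum_oddBelowTerm]
    ring
  have hA0 : ∑' p, antisymmTerm (q + 1) p = 0 := by
    rw [hA.tsum_prod]
    simp [tsum_antisymmTerm_row]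
  have hB0 : ∑' p, telescopingTerm (q + 1) p = 0 := by
    have hB' : Summable fun p : ℕ × ℕ => telescopingTerm (q + 1) p.swap :=
      hB.comp_injective Prod.swap_injective
    rw [← (Equiv.prodComm ℕ ℕ).tsum_eq]
    refine (hB'.tsum_prod).trans ?_
    simp only [Prod.swap_prod_mk]
    rw [tsum_congr fun n => tsum_telescopingTerm_column (q + 1) n (hB'.prod_factor n), tsum_zero]
  have hIcc : Finset.Icc 2 (q + 1 + 2 - 1) = Finset.Ico 2 (q + 1 + 2) := by
    ext j
    simp only [Finset.mem_Icc, Finset.mem_Ico]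
    omega
  simp only [levelTwoDoubleZeta_eq_tsum]
  rw [hIcc, Finset.sum_Ico_eq_sum_range, ← Finset.mul_sum, Nat.add_sub_cancel]
  have hre : ∀ i ∈ Finset.range (q + 1), ∑' p, oddBelowTerm (2 + i) (q + 1 + 2 - (2 + i)) p
      = ∑' p, oddBelowTerm (i + 2) (q + 1 - i) p := by
    intro i _
    rw [add_comm 2 i, Nat.add_sub_add_right]
  rw [Finset.sum_congr rfl hre, ← Summable.tsum_finsetSum hF,
    tsum_congr (sum_oddBelowTerm (q + 1)), (hA.add hB).tsum_add hD.summable, hA.tsum_add hB,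
    hA0, hB0, hD.tsum_eq]
  push_cast
  ring
end

section
/- Let ω = exp(2πi/3). For every integer k ≥ 3, Σ_{j=2}^{k−1} ζ^{(3)}(j, \overline{k−j}) = ζ^{(3)}(\overline{k−1}, 1) − ζ^{(3)}(\overline{k−1}, \widetilde{1}) + ζ^{(3)}(\overline{k}), i.e. Σ_{j=2}^{k−1} Σ_{m>n>0} ω^{n}/(m^j n^{k−j}) = Σ_{m>n>0} ω^{m}/(m^{k−1} n) − Σ_{m>n>0} ω^{m+2n}/(m^{k−1} n) + Σ_{m>0} ω^{m}/m^{k}. -/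
/-- `ω = exp(2πi/3)`, a primitive cube root of unity. -/
noncomputable def omega3 : ℂ := Complex.exp (2 * (Real.pi : ℂ) * Complex.I / 3)

/-- The index set `m > n > 0`, parametrised by `(m, n) = (a + b + 2, b + 1)`. -/
def natProdEquivGtPos : ℕ × ℕ ≃ {p : ℕ × ℕ // p.2 < p.1 ∧ 0 < p.2} where
  toFun q := ⟨(q.1 + q.2 + 2, q.2 + 1), by constructor <;> simp only <;> omega⟩
  invFun p := (p.1.1 - p.1.2 - 1, p.1.2 - 1)
  left_inv q := by ext <;> simp only <;> omega
  right_inv p := by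
    obtain ⟨⟨m, n⟩, h1, h2⟩ := p
    simp only at h1 h2
    ext <;> simp only <;> omega

theorem tsum_gt_pos_eq (f : ℕ → ℕ → ℂ) :
    ∑' p : {p : ℕ × ℕ // p.2 < p.1 ∧ 0 < p.2}, f p.1.1 p.1.2
      = ∑' q : ℕ × ℕ, f (q.1 + q.2 + 2) (q.2 + 1) :=
  (natProdEquivGtPos.tsum_eq
    (fun p : {p : ℕ × ℕ // p.2 < p.1 ∧ 0 < p.2} => f p.1.1 p.1.2)).symm

theorem tsum_pos_eq (f : ℕ → ℂ) : ∑' m : {m : ℕ // 0 < m}, f m.1 = ∑' b : ℕ, f (b + 1) :=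
  (Equiv.pnatEquivNat.symm.tsum_eq (fun m : ℕ+ => f m)).symm

theorem omega3_pow_three : omega3 ^ 3 = 1 := by
  rw [omega3, ← Complex.exp_nat_mul, ← Complex.exp_two_pi_mul_I]
  congr 1
  push_cast
  ring

theorem norm_omega3 : ‖omega3‖ = 1 :=
  Complex.norm_eq_one_of_pow_eq_one omega3_pow_three (by norm_num)

theorem summable_one_div_tornheim :
    Summable fun q : ℕ × ℕ =>
      1 / (((q.1 : ℝ) + 1) * ((q.2 : ℝ) + 1) * ((q.1 : ℝ) + q.2 + 2)) := by
  have h1 : Summable fun n : ℕ => 1 / ((n : ℝ) + 1) ^ (3 / 2 : ℝ) := by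
    have h := (summable_nat_add_iff 1).2
      ((Real.summable_one_div_nat_rpow (p := 3 / 2)).2 (by norm_num))
    simpa using h
  have h0 : ∀ n : ℕ, 0 ≤ 1 / ((n : ℝ) + 1) ^ (3 / 2 : ℝ) := fun n => by positivity
  refine Summable.of_nonneg_of_le (fun q => by positivity) (fun q => ?_)
    (h1.mul_of_nonneg h1 h0 h0)
  have hx : (0 : ℝ) < (q.1 : ℝ) + 1 := by positivity
  have hy : (0 : ℝ) < (q.2 : ℝ) + 1 := by positivity
  have hpow : ∀ x : ℝ, 0 < x → x ^ (3 / 2 : ℝ) = x * √x := fun x h => by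
    rw [show (3 / 2 : ℝ) = 1 + 1 / 2 by norm_num, Real.rpow_add h, Real.rpow_one,
      Real.sqrt_eq_rpow]
  rw [hpow _ hx, hpow _ hy, one_div_mul_one_div]
  refine one_div_le_one_div_of_le (by positivity) ?_
  have key : √((q.1 : ℝ) + 1) * √((q.2 : ℝ) + 1) ≤ (q.1 : ℝ) + q.2 + 2 := by
    have := Real.sq_sqrt hx.le
    have := Real.sq_sqrt hy.le
    nlinarith [sq_nonneg (√((q.1 : ℝ) + 1) - √((q.2 : ℝ) + 1))]
  calc ((q.1 : ℝ) + 1) * √((q.1 : ℝ) + 1) * (((q.2 : ℝ) + 1) * √((q.2 : ℝ) + 1))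
      = ((q.1 : ℝ) + 1) * ((q.2 : ℝ) + 1) * (√((q.1 : ℝ) + 1) * √((q.2 : ℝ) + 1)) := by ring
    _ ≤ _ := by gcongr

/-- Series dominated by `1 / (x y (x + y))`. -/
theorem summable_omega3_pow_div (e : ℕ × ℕ → ℕ) (d : ℕ × ℕ → ℝ)
    (hd : ∀ q : ℕ × ℕ, ((q.1 : ℝ) + 1) * ((q.2 : ℝ) + 1) * ((q.1 : ℝ) + q.2 + 2) ≤ d q) :
    Summable fun q : ℕ × ℕ => omega3 ^ e q / (d q : ℂ) := by
  refine Summable.of_norm_bounded summable_one_div_tornheim (fun q => ?_)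
  have h0 : (0 : ℝ) < ((q.1 : ℝ) + 1) * ((q.2 : ℝ) + 1) * ((q.1 : ℝ) + q.2 + 2) := by positivity
  rw [norm_div, norm_pow, norm_omega3, one_pow, Complex.norm_real, Real.norm_eq_abs,
    abs_of_pos (h0.trans_le (hd q))]
  exact one_div_le_one_div_of_le h0 (hd q)

theorem tornheim_le_pow_mul_pow (x y : ℝ) (hx : 1 ≤ x) (hy : 1 ≤ y) {i j : ℕ} (hi : 2 ≤ i)
    (hj : 1 ≤ j) : x * y * (x + y) ≤ (x + y) ^ i * y ^ j :=
  calc x * y * (x + y) ≤ (x + y) * y * (x + y) := by gcongr; linarith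
    _ = (x + y) ^ 2 * y ^ 1 := by ring
    _ ≤ _ := by (gcongr; all_goals linarith)

theorem hasSum_sub_one_div (i : ℕ) :
    HasSum (fun a : ℕ => 1 / ((a : ℝ) + i + 1) - 1 / ((a : ℝ) + i + 2)) (1 / ((i : ℝ) + 1)) := by
  rw [hasSum_iff_tendsto_nat_of_nonneg]
  · have h : ∀ n : ℕ, ∑ a ∈ Finset.range n, (1 / ((a : ℝ) + i + 1) - 1 / ((a : ℝ) + i + 2))
        = 1 / ((i : ℝ) + 1) - 1 / (((n + i : ℕ) : ℝ) + 1) := fun n => by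
      have := Finset.sum_range_sub' (fun a : ℕ => 1 / ((a : ℝ) + i + 1)) n
      simp only [Nat.cast_zero, zero_add] at this
      rw [Nat.cast_add, ← this]
      refine Finset.sum_congr rfl fun a _ => ?_
      push_cast
      ring
    simp only [h]
    have h2 := (Filter.tendsto_add_atTop_iff_nat i).2
      (tendsto_one_div_add_atTop_nhds_zero_nat (𝕜 := ℝ))
    simpa using h2.const_sub (1 / ((i : ℝ) + 1))
  · intro a
    rw [sub_nonneg]
    exact one_div_le_one_div_of_le (by positivity) (by linarith)

theorem hasSum_one_div_add_mul (b : ℕ) :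
    HasSum (fun a : ℕ => 1 / (((a : ℂ) + b + 2) * ((a : ℂ) + 1)))
      ((∑ i ∈ Finset.range (b + 1), 1 / ((i : ℂ) + 1)) / ((b : ℂ) + 1)) := by
  have h := (hasSum_sum (s := Finset.range (b + 1))
    (fun i _ => hasSum_sub_one_div i)).div_const ((b : ℝ) + 1)
  have h2 := Complex.hasSum_ofReal.2 h
  convert h2 using 1
  · funext a
    have h3 := Finset.sum_range_sub' (fun i : ℕ => 1 / ((a : ℝ) + i + 1)) (b + 1)
    have h4 : ∑ i ∈ Finset.range (b + 1), (1 / ((a : ℝ) + i + 1) - 1 / ((a : ℝ) + i + 2))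
        = 1 / ((a : ℝ) + 1) - 1 / ((a : ℝ) + b + 2) := by
      trans 1 / ((a : ℝ) + (0 : ℕ) + 1) - 1 / ((a : ℝ) + (b + 1 : ℕ) + 1)
      · rw [← h3]
        refine Finset.sum_congr rfl fun i _ => ?_
        push_cast
        ring
      · push_cast
        ring
    have h5 : 1 / (((a : ℝ) + b + 2) * ((a : ℝ) + 1))
        = (1 / ((a : ℝ) + 1) - 1 / ((a : ℝ) + b + 2)) / ((b : ℝ) + 1) := by
      field_simp
      ring
    rw [h4, ← h5]
    push_cast
    rfl
  · push_cast
    rfl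

theorem sum_Icc_one_div_pow_mul_pow (x y : ℂ) (hx : x ≠ 0) (hy : y ≠ 0) (hxy : x + y ≠ 0)
    (l : ℕ) :
    ∑ j ∈ Finset.Icc 2 (l + 2), 1 / ((x + y) ^ j * y ^ (l + 3 - j))
      = 1 / (y ^ (l + 1) * ((x + y) * x)) - 1 / ((x + y) ^ (l + 2) * x) := by
  induction l with
  | zero =>
    simp
    field_simp
    ring
  | succ l ih =>
    have h : ∀ j ∈ Finset.Icc 2 (l + 2), 1 / ((x + y) ^ j * y ^ (l + 1 + 3 - j))
        = 1 / ((x + y) ^ j * y ^ (l + 3 - j)) * (1 / y) := fun j hj => by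
      rw [Finset.mem_Icc] at hj
      rw [show l + 1 + 3 - j = l + 3 - j + 1 by omega, pow_succ]
      field_simp
    rw [show l + 1 + 2 = l + 2 + 1 by ring, Finset.sum_Icc_succ_top (by omega),
      Finset.sum_congr rfl h, ← Finset.sum_mul, ih, show l + 1 + 3 - (l + 2 + 1) = 1 by omega]
    field_simp
    ring

theorem summable_omega3_pow_div_mul_mul (l : ℕ) :
    Summable fun q : ℕ × ℕ => omega3 ^ (q.2 + 1) /
        (((q.2 : ℂ) + 1) ^ (l + 1) * (((q.1 : ℂ) + q.2 + 2) * ((q.1 : ℂ) + 1))) := by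
  have := summable_omega3_pow_div (fun q => q.2 + 1)
    (fun q => ((q.2 : ℝ) + 1) ^ (l + 1) * (((q.1 : ℝ) + q.2 + 2) * ((q.1 : ℝ) + 1)))
    (fun q => by
      have h : (q.2 : ℝ) + 1 ≤ ((q.2 : ℝ) + 1) ^ (l + 1) :=
        le_self_pow₀ (by linarith [Nat.cast_nonneg (α := ℝ) q.2]) (by omega)
      calc _ = ((q.2 : ℝ) + 1) * (((q.1 : ℝ) + q.2 + 2) * ((q.1 : ℝ) + 1)) := by ring
        _ ≤ _ := by gcongr)
  exact_mod_cast this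

/-- Summing `ω ^ n / (n ^ (l + 1) m (m - n))` over `m > n > 0`, first in `m`. -/
theorem tsum_omega3_pow_div_mul_mul (l : ℕ) :
    ∑' q : ℕ × ℕ, omega3 ^ (q.2 + 1) /
        (((q.2 : ℂ) + 1) ^ (l + 1) * (((q.1 : ℂ) + q.2 + 2) * ((q.1 : ℂ) + 1)))
      = ∑' q : ℕ × ℕ, omega3 ^ (q.1 + q.2 + 2) /
          (((q.1 : ℂ) + q.2 + 2) ^ (l + 2) * ((q.2 : ℂ) + 1))
        + ∑' b : ℕ, omega3 ^ (b + 1) / ((b : ℂ) + 1) ^ (l + 3) := by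
  have hs1 := summable_omega3_pow_div_mul_mul l
  have hs2 : Summable fun q : ℕ × ℕ => omega3 ^ (q.1 + q.2 + 2) /
          (((q.1 : ℂ) + q.2 + 2) ^ (l + 2) * ((q.2 : ℂ) + 1)) := by
    have := summable_omega3_pow_div (fun q => q.1 + q.2 + 2)
      (fun q => ((q.1 : ℝ) + q.2 + 2) ^ (l + 2) * ((q.2 : ℝ) + 1))
      (fun q => by
        have := tornheim_le_pow_mul_pow ((q.1 : ℝ) + 1) ((q.2 : ℝ) + 1) (by simp) (by simp)
          (show 2 ≤ l + 2 by omega) le_rfl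
        rw [show (q.1 : ℝ) + q.2 + 2 = q.1 + 1 + (q.2 + 1) by ring]
        simpa using this)
    exact_mod_cast this
  have hs3 : Summable fun b : ℕ => omega3 ^ (b + 1) / ((b : ℂ) + 1) ^ (l + 3) := by
    have h := (summable_nat_add_iff 1).2
      ((Real.summable_one_div_nat_pow (p := l + 3)).2 (by omega))
    refine Summable.of_norm_bounded h fun b => le_of_eq ?_
    rw [norm_div, norm_pow, norm_omega3, norm_pow, one_pow]
    norm_cast
  have hinner : ∀ b : ℕ, HasSum (fun a : ℕ => omega3 ^ (b + 1) /
        (((b : ℂ) + 1) ^ (l + 1) * (((a : ℂ) + b + 2) * ((a : ℂ) + 1))))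
      (omega3 ^ (b + 1) / ((b : ℂ) + 1) ^ (l + 2) * ∑ i ∈ Finset.range b, 1 / ((i : ℂ) + 1)
        + omega3 ^ (b + 1) / ((b : ℂ) + 1) ^ (l + 3)) := fun b => by
    have hb : (b : ℂ) + 1 ≠ 0 := Nat.cast_add_one_ne_zero b
    have h := (hasSum_one_div_add_mul b).mul_left (omega3 ^ (b + 1) / ((b : ℂ) + 1) ^ (l + 1))
    rw [Finset.sum_range_succ] at h
    have hsum : ∀ S : ℂ, omega3 ^ (b + 1) / ((b : ℂ) + 1) ^ (l + 1)
          * ((S + 1 / ((b : ℂ) + 1)) / ((b : ℂ) + 1))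
        = omega3 ^ (b + 1) / ((b : ℂ) + 1) ^ (l + 2) * S
          + omega3 ^ (b + 1) / ((b : ℂ) + 1) ^ (l + 3) := fun S => by
      field_simp
      ring
    rw [hsum] at h
    simpa only [div_mul_div_comm, mul_one] using h
  have hswap : Summable fun q : ℕ × ℕ => omega3 ^ (q.1 + 1) /
        (((q.1 : ℂ) + 1) ^ (l + 1) * (((q.2 : ℂ) + q.1 + 2) * ((q.2 : ℂ) + 1))) :=
    (Equiv.prodComm ℕ ℕ).summable_iff.2 hs1
  have hout := (hswap.hasSum.prod_fiberwise hinner)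
  have hL : ∑' q : ℕ × ℕ, omega3 ^ (q.2 + 1) /
        (((q.2 : ℂ) + 1) ^ (l + 1) * (((q.1 : ℂ) + q.2 + 2) * ((q.1 : ℂ) + 1)))
      = ∑' q : ℕ × ℕ, omega3 ^ (q.1 + 1) /
        (((q.1 : ℂ) + 1) ^ (l + 1) * (((q.2 : ℂ) + q.1 + 2) * ((q.2 : ℂ) + 1))) :=
    ((Equiv.prodComm ℕ ℕ).tsum_eq (fun q : ℕ × ℕ => omega3 ^ (q.2 + 1) /
        (((q.2 : ℂ) + 1) ^ (l + 1) * (((q.1 : ℂ) + q.2 + 2) * ((q.1 : ℂ) + 1))))).symm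
  have hdiag : HasSum (fun b : ℕ => omega3 ^ (b + 1) / ((b : ℂ) + 1) ^ (l + 2) *
        ∑ i ∈ Finset.range b, 1 / ((i : ℂ) + 1))
      (∑' q : ℕ × ℕ, omega3 ^ (q.1 + q.2 + 2) /
          (((q.1 : ℂ) + q.2 + 2) ^ (l + 2) * ((q.2 : ℂ) + 1))) := by
    rw [← hasSum_nat_add_iff' 1]
    have h := (Finset.HasAntidiagonal.sigmaAntidiagonalEquivProd (A := ℕ)).hasSum_iff.2 hs2.hasSum
    have h2 := h.sigma fun n => hasSum_fintype _
    convert! h2 using 1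
    · funext n
      rw [Finset.mul_sum]
      simp only [Function.comp_apply, Finset.HasAntidiagonal.sigmaAntidiagonalEquivProd_apply]
      rw [Finset.univ_eq_attach, Finset.sum_attach (Finset.HasAntidiagonal.antidiagonal n)
        (fun q : ℕ × ℕ => omega3 ^ (q.1 + q.2 + 2) /
          (((q.1 : ℂ) + q.2 + 2) ^ (l + 2) * ((q.2 : ℂ) + 1))),
        ← Finset.Nat.sum_antidiagonal_swap,
        Finset.Nat.sum_antidiagonal_eq_sum_range_succ_mk]
      refine Finset.sum_congr rfl fun i hi => ?_
      have hi' : i ≤ n := by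
        rw [Finset.mem_range] at hi
        omega
      simp only [Prod.fst_swap, Prod.snd_swap]
      rw [div_mul_div_comm, mul_one, ← Nat.cast_add, Nat.sub_add_cancel hi']
      push_cast
      ring
    · simp
  rw [hL]
  exact hout.unique (hdiag.add hs3.hasSum)

theorem sum_formula_level3 (k : ℕ) (hk : 3 ≤ k) :
    (∑ j ∈ Finset.Icc 2 (k - 1),
        ∑' p : {p : ℕ × ℕ // p.2 < p.1 ∧ 0 < p.2},
          omega3 ^ p.1.2 / ((p.1.1 : ℂ) ^ j * (p.1.2 : ℂ) ^ (k - j)))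
      = (∑' p : {p : ℕ × ℕ // p.2 < p.1 ∧ 0 < p.2},
            omega3 ^ p.1.1 / ((p.1.1 : ℂ) ^ (k - 1) * (p.1.2 : ℂ)))
        - (∑' p : {p : ℕ × ℕ // p.2 < p.1 ∧ 0 < p.2},
            omega3 ^ (p.1.1 + 2 * p.1.2) / ((p.1.1 : ℂ) ^ (k - 1) * (p.1.2 : ℂ)))
        + ∑' m : {m : ℕ // 0 < m}, omega3 ^ m.1 / (m.1 : ℂ) ^ k := by
  obtain ⟨l, rfl⟩ := Nat.exists_eq_add_of_le' hk
  rw [show l + 3 - 1 = l + 2 by omega]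
  rw [tsum_gt_pos_eq (fun m n => omega3 ^ m / ((m : ℂ) ^ (l + 2) * (n : ℂ))),
    tsum_gt_pos_eq (fun m n => omega3 ^ (m + 2 * n) / ((m : ℂ) ^ (l + 2) * (n : ℂ))),
    tsum_pos_eq (fun m => omega3 ^ m / (m : ℂ) ^ (l + 3)),
    Finset.sum_congr rfl fun j _ =>
      tsum_gt_pos_eq (fun m n => omega3 ^ n / ((m : ℂ) ^ j * (n : ℂ) ^ (l + 3 - j)))]
  push_cast
  rw [sub_add_eq_add_sub, ← tsum_omega3_pow_div_mul_mul]
  have hs : ∀ j ∈ Finset.Icc 2 (l + 2), Summable fun q : ℕ × ℕ => omega3 ^ (q.2 + 1) /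
      (((q.1 : ℂ) + q.2 + 2) ^ j * ((q.2 : ℂ) + 1) ^ (l + 3 - j)) := fun j hj => by
    rw [Finset.mem_Icc] at hj
    have := summable_omega3_pow_div (fun q => q.2 + 1)
      (fun q => ((q.1 : ℝ) + q.2 + 2) ^ j * ((q.2 : ℝ) + 1) ^ (l + 3 - j))
      (fun q => by
        rw [show (q.1 : ℝ) + q.2 + 2 = q.1 + 1 + (q.2 + 1) by ring]
        exact tornheim_le_pow_mul_pow _ _ (by simp) (by simp) hj.1 (by omega))
    exact_mod_cast this
  have hs1 := summable_omega3_pow_div_mul_mul l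
  have hs2 : Summable fun q : ℕ × ℕ => omega3 ^ (q.2 + 1) /
        (((q.1 : ℂ) + q.2 + 2) ^ (l + 2) * ((q.1 : ℂ) + 1)) := by
    have := summable_omega3_pow_div (fun q => q.2 + 1)
      (fun q => ((q.1 : ℝ) + q.2 + 2) ^ (l + 2) * ((q.1 : ℝ) + 1))
      (fun q => by
        have := tornheim_le_pow_mul_pow ((q.2 : ℝ) + 1) ((q.1 : ℝ) + 1) (by simp) (by simp)
          (show 2 ≤ l + 2 by omega) le_rfl
        rw [show (q.1 : ℝ) + q.2 + 2 = q.2 + 1 + (q.1 + 1) by ring,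
          mul_comm ((q.1 : ℝ) + 1)]
        simpa using this)
    exact_mod_cast this
  have hswap : ∑' q : ℕ × ℕ, omega3 ^ (q.1 + q.2 + 2 + 2 * (q.2 + 1)) /
        (((q.1 : ℂ) + q.2 + 2) ^ (l + 2) * ((q.2 : ℂ) + 1))
      = ∑' q : ℕ × ℕ, omega3 ^ (q.2 + 1) /
        (((q.1 : ℂ) + q.2 + 2) ^ (l + 2) * ((q.1 : ℂ) + 1)) := by
    rw [← (Equiv.prodComm ℕ ℕ).tsum_eq]
    refine tsum_congr fun q => ?_
    simp only [Equiv.prodComm_apply, Prod.fst_swap, Prod.snd_swap]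
    rw [show q.2 + q.1 + 2 + 2 * (q.1 + 1) = q.2 + 1 + 3 * (q.1 + 1) by ring, pow_add,
      pow_mul, omega3_pow_three, one_pow, mul_one, add_comm (q.2 : ℂ)]
  rw [hswap, ← Summable.tsum_finsetSum hs, ← hs1.tsum_sub hs2]
  refine tsum_congr fun q => ?_
  have hne : ∀ n : ℕ, (n : ℂ) + 1 ≠ 0 := Nat.cast_add_one_ne_zero
  have hxy : (q.1 : ℂ) + 1 + (q.2 + 1) ≠ 0 := by
    have := hne (q.1 + q.2 + 1)
    push_cast at this
    convert this using 1
    ring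
  have key := sum_Icc_one_div_pow_mul_pow ((q.1 : ℂ) + 1) ((q.2 : ℂ) + 1) (hne _) (hne _) hxy l
  rw [show (q.1 : ℂ) + 1 + (q.2 + 1) = q.1 + q.2 + 2 by ring] at key
  simp only [div_eq_mul_one_div (omega3 ^ (q.2 + 1))]
  rw [← Finset.mul_sum, key, mul_sub]
end
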